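/- Let $p$ be a prime with $p \equiv 3 \pmod{8}$. Then $Q(p, S_4) = \frac{1}{2}\left\lfloor \frac{p-1}{4} \right\rfloor$, i.e. $2\,Q(p, S_4) = \left\lfloor \frac{p-1}{4} \right\rfloor$. -/

import Mathlib

/-- `a` is a quadratic residue modulo `p`: the congruence `x^2 ≡ a (mod p)` has a solution in `ℤ`. -/
def IsQR (p a : ℕ) : Prop := ∃ x : ℤ, x ^ 2 ≡ (a : ℤ) [ZMOD (p : ℤ)]

open Classical in
/-- `Q(p, S_k)`: the number of quadratic residues modulo `p` in `[1, p-1]` that are multiples of `k`. -/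
noncomputable def Qcount (p k : ℕ) : ℕ :=
  ((Finset.Icc 1 (p - 1)).filter fun a => k ∣ a ∧ IsQR p a).card

open Classical in
/-- `N(p, S_k)`: the number of quadratic non-residues modulo `p` in `[1, p-1]` that are multiples of `k`. -/
noncomputable def Ncount (p k : ℕ) : ℕ :=
  ((Finset.Icc 1 (p - 1)).filter fun a => k ∣ a ∧ ¬ IsQR p a).card

open Classical in
/-- `Q(p, 𝒪)`: the number of quadratic residues modulo `p` among the odd integers in `[1, p-1]`. -/
noncomputable def QcountOdd (p : ℕ) : ℕ :=
  ((Finset.Icc 1 (p - 1)).filter fun a => Odd a ∧ IsQR p a).card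

open Classical in
/-- `Q(p, S_2 \ S_4)`: the number of quadratic residues modulo `p` in `[1, p-1]`
divisible by `2` but not by `4`. -/
noncomputable def Qcount2not4 (p : ℕ) : ℕ :=
  ((Finset.Icc 1 (p - 1)).filter fun a => (2 ∣ a ∧ ¬ (4 ∣ a)) ∧ IsQR p a).card

theorem isQR_iff_isSquare (p a : ℕ) : IsQR p a ↔ IsSquare (a : ZMod p) := by
  constructor
  · rintro ⟨x, hx⟩
    refine ⟨(x : ZMod p), ?_⟩
    have := (ZMod.intCast_eq_intCast_iff _ _ p).2 hx
    push_cast at this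
    rw [← this, sq]
  · rintro ⟨y, hy⟩
    obtain ⟨x, rfl⟩ := ZMod.intCast_surjective y
    refine ⟨x, (ZMod.intCast_eq_intCast_iff _ _ p).1 ?_⟩
    push_cast
    rw [hy, sq]

/-- A function on `ℕ` that is odd under `k ↦ p - k` and changes sign under doubling has
vanishing sum over the first quarter of `[0, p]`, for `p = 8 * m + 3`. -/
theorem sum_range_quarter_eq_zero (f : ℕ → ℤ) (m : ℕ) (h_two : ∀ k, f (2 * k) = -f k)
    (h_refl : ∀ k ≤ 8 * m + 3, f (8 * m + 3 - k) = -f k) :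
    ∑ k ∈ Finset.range (2 * m + 1), f k = 0 := by
  have parity : ∀ n, ∑ k ∈ Finset.range (n + n), f k =
      ∑ i ∈ Finset.range n, f (2 * i) + ∑ i ∈ Finset.range n, f (2 * i + 1) := by
    intro n
    induction n with
    | zero => simp
    | succ n ih =>
      rw [show n + 1 + (n + 1) = n + n + 1 + 1 by ring]
      simp only [Finset.sum_range_succ, ih]
      rw [← two_mul]
      ring
  have odd_part : ∑ i ∈ Finset.range (2 * m + 1), f (2 * i + 1) =
      ∑ i ∈ Finset.range (2 * m + 1), f (2 * m + 1 + i) := by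
    rw [← Finset.sum_range_reflect (fun i => f (2 * m + 1 + i))]
    refine Finset.sum_congr rfl fun i hi => ?_
    rw [Finset.mem_range] at hi
    have h₁ := h_refl (2 * i + 1) (by omega)
    rw [show 8 * m + 3 - (2 * i + 1) = 2 * (2 * m + 1 + (2 * m + 1 - 1 - i)) by omega,
      h_two] at h₁
    linarith
  have key := parity (2 * m + 1)
  rw [Finset.sum_range_add, odd_part] at key
  simp only [h_two, Finset.sum_neg_distrib] at key
  linarith

open Classical in
theorem Qcount_eq_card_filter_mul (p k : ℕ) (hk : 0 < k) :
    Qcount p k = ((Finset.Icc 1 ((p - 1) / k)).filter fun a => IsQR p (k * a)).card := by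
  rw [Qcount, eq_comm, ← Finset.card_image_of_injective _ (mul_right_injective₀ hk.ne')]
  congr 1
  ext a
  simp only [Finset.mem_filter, Finset.mem_Icc, Finset.mem_image]
  constructor
  · rintro ⟨b, ⟨⟨h₁, h₂⟩, h₃⟩, rfl⟩
    have := (Nat.le_div_iff_mul_le hk).1 h₂
    exact ⟨⟨Nat.mul_pos hk h₁, by linarith⟩, dvd_mul_right _ _, h₃⟩
  · rintro ⟨⟨h₁, h₂⟩, ⟨b, rfl⟩, h₃⟩
    exact ⟨b, ⟨⟨Nat.pos_of_mul_pos_left h₁, (Nat.le_div_iff_mul_le hk).2 (by linarith)⟩, h₃⟩, rfl⟩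

theorem stmt8 (p : ℕ) (hp : p.Prime) (h : p % 8 = 3) :
    2 * Qcount p 4 = (p - 1) / 4 := by
  classical
  have : Fact p.Prime := ⟨hp⟩
  obtain ⟨m, rfl⟩ : ∃ m, p = 8 * m + 3 := ⟨p / 8, by omega⟩
  set p := 8 * m + 3 with p_def
  have h_two : ∀ k : ℕ, legendreSym p ((2 * k : ℕ) : ℤ) = -legendreSym p (k : ℤ) := by
    intro k
    have : legendreSym p 2 = -1 := by
      rw [legendreSym.at_two (by omega), ZMod.χ₈_nat_mod_eight, h]
      decide
    push_cast
    rw [legendreSym.mul, this, neg_one_mul]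
  have h_refl : ∀ k ≤ p, legendreSym p ((p - k : ℕ) : ℤ) = -legendreSym p (k : ℤ) := by
    intro k hk
    have h_neg : legendreSym p (-1) = -1 := by
      rw [legendreSym.at_neg_one (by omega), ZMod.χ₄_nat_three_mod_four (by omega)]
    rw [← neg_one_mul, ← h_neg, ← legendreSym.mul, legendreSym.mod, legendreSym.mod p (-1 * _)]
    congr 1
    push_cast [hk]
    rw [show (p : ℤ) - k = -1 * k + p by ring, Int.add_emod_right]
  have sum_zero := sum_range_quarter_eq_zero (fun k => legendreSym p (k : ℤ)) m h_two h_refl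
  have quarter : (p - 1) / 4 = 2 * m := by omega
  rw [Finset.sum_range_succ'] at sum_zero
  rw [Qcount_eq_card_filter_mul p 4 (by norm_num), quarter,
    ← Finset.Ico_add_one_right_eq_Icc]
  have indicator : ∀ a ∈ Finset.Ico 1 (2 * m + 1),
      (2 : ℤ) * (if IsQR p (4 * a) then 1 else 0) = 1 + legendreSym p (a : ℤ) := by
    intro a ha
    rw [Finset.mem_Ico] at ha
    have h_four : legendreSym p ((4 * a : ℕ) : ℤ) = legendreSym p (a : ℤ) := by
      rw [show 4 * a = 2 * (2 * a) by ring, h_two, h_two, neg_neg]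
    have h_ne : ((4 * a : ℕ) : ZMod p) ≠ 0 := by
      rw [Ne, ZMod.natCast_eq_zero_iff]
      exact Nat.not_dvd_of_pos_of_lt (by omega) (by omega)
    rw [← h_four]
    split_ifs with hq
    · rw [(legendreSym.eq_one_iff' p h_ne).2 ((isQR_iff_isSquare _ _).1 hq)]
      norm_num
    · rw [(legendreSym.eq_neg_one_iff' p).2 (fun hs => hq ((isQR_iff_isSquare _ _).2 hs))]
      norm_num
  zify
  rw [Finset.card_filter]
  push_cast
  rw [Finset.mul_sum, Finset.sum_congr rfl indicator, Finset.sum_add_distrib,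
    Finset.sum_Ico_eq_sum_range (fun a : ℕ => legendreSym p (a : ℤ))]
  simp only [Nat.add_sub_cancel, add_comm 1]
  simp at sum_zero ⊢
  exact sum_zero
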